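/- Let X be a real Banach space and let F : [0,1] → (nonempty bounded subsets of X) be a Riemann integrable multifunction. Then the multifunction conv F : t ↦ conv(F(t)) is also Riemann integrable and ∫₀¹ conv F(t) dt = ∫₀¹ F(t) dt. -/

import Mathlib

open Pointwise

/-- A tagged partition of the interval `[0,1]`: subdivision points
`x 0 = 0 ≤ x 1 ≤ … ≤ x n = 1` together with tags `t i ∈ [x i, x (i+1)]`. -/
structure TaggedPartition where
  n : ℕ
  npos : 0 < n
  x : Fin (n + 1) → ℝ
  t : Fin n → ℝ
  mono : Monotone x
  x_zero : x 0 = 0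
  x_last : x (Fin.last n) = 1
  tag_mem : ∀ i : Fin n, t i ∈ Set.Icc (x i.castSucc) (x i.succ)

/-- The mesh `d(T)` of a tagged partition: the largest length of a subinterval. -/
noncomputable def TaggedPartition.mesh (T : TaggedPartition) : ℝ :=
  ⨆ i : Fin T.n, (T.x i.succ - T.x i.castSucc)

/-- The Riemann sum `S(F,T) = ∑ |Δ i| • F (t i)` of a multifunction `F`,
where the sum of sets is the Minkowski sum. -/
noncomputable def setRiemannSum {X : Type*} [NormedAddCommGroup X] [NormedSpace ℝ X]
    (F : ℝ → Set X) (T : TaggedPartition) : Set X :=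
  ∑ i : Fin T.n, (T.x i.succ - T.x i.castSucc) • F (T.t i)

/-- A closed bounded nonempty set `A` is the Riemann integral of the multifunction `F` if
the Riemann sums of `F` converge to `A` in the Hausdorff distance as the mesh tends to `0`. -/
def IsSetRiemannIntegral {X : Type*} [NormedAddCommGroup X] [NormedSpace ℝ X]
    (F : ℝ → Set X) (A : Set X) : Prop :=
  A.Nonempty ∧ IsClosed A ∧ Bornology.IsBounded A ∧
    ∀ ε > 0, ∃ δ > 0, ∀ T : TaggedPartition, T.mesh < δ →
      Metric.hausdorffDist (setRiemannSum F T) A < ε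

/-- A multifunction is Riemann integrable if it has a Riemann integral. -/
def SetRiemannIntegrable {X : Type*} [NormedAddCommGroup X] [NormedSpace ℝ X]
    (F : ℝ → Set X) : Prop :=
  ∃ A : Set X, IsSetRiemannIntegral F A

/-- `F` is a multifunction on `[0,1]` with nonempty bounded values. -/
def IsMultifunction {X : Type*} [NormedAddCommGroup X] (F : ℝ → Set X) : Prop :=
  ∀ t ∈ Set.Icc (0 : ℝ) 1, (F t).Nonempty ∧ Bornology.IsBounded (F t)

open Set Metric Bornology

namespace TaggedPartition

/-- The tagged partition cut out of sequences of subdivision points and tags. -/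
def ofSeq (n : ℕ) (hn : 0 < n) (x t : ℕ → ℝ) (hx0 : x 0 = 0) (hxn : x n = 1)
    (ht : ∀ i, t i ∈ Icc (x i) (x (i + 1))) : TaggedPartition where
  n := n
  npos := hn
  x i := x i
  t i := t i
  mono _ _ hij := monotone_nat_of_le_succ (fun i => (ht i).1.trans (ht i).2) hij
  x_zero := hx0
  x_last := hxn
  tag_mem i := ht i

theorem mesh_ofSeq_le {n : ℕ} {hn : 0 < n} {x t : ℕ → ℝ} {hx0 : x 0 = 0} {hxn : x n = 1}
    {ht : ∀ i, t i ∈ Icc (x i) (x (i + 1))} {r : ℝ} (h : ∀ i, x (i + 1) - x i ≤ r) :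
    (ofSeq n hn x t hx0 hxn ht).mesh ≤ r :=
  have : Nonempty (Fin (ofSeq n hn x t hx0 hxn ht).n) := ⟨⟨0, hn⟩⟩
  ciSup_le fun i : Fin n => h i

theorem tag_mem_Icc (T : TaggedPartition) (i : Fin T.n) : T.t i ∈ Icc (0 : ℝ) 1 := by
  refine ⟨?_, (T.tag_mem i).2.trans ?_⟩
  · rw [← T.x_zero]
    exact (T.mono (Fin.zero_le _)).trans (T.tag_mem i).1
  · rw [← T.x_last]
    exact T.mono (Fin.le_last _)

theorem uniform_length (N i : ℕ) : ((i + 1 : ℕ) : ℝ) / N - i / N = 1 / N := by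
  push_cast
  ring

theorem uniformSplit_length_even (N k : ℕ) (a : ℝ) :
    (((2 * k + 1) / 2 : ℕ) + ((2 * k + 1) % 2 : ℕ) * a) / N
      - (((2 * k) / 2 : ℕ) + ((2 * k) % 2 : ℕ) * a) / (N : ℝ) = a * (1 / N) := by
  have h1 : (2 * k + 1) / 2 = k := by omega
  have h2 : (2 * k + 1) % 2 = 1 := by omega
  rw [h1, h2, Nat.mul_div_cancel_left k two_pos, Nat.mul_mod_right]
  push_cast
  ring

theorem uniformSplit_length_odd (N k : ℕ) (a : ℝ) :
    (((2 * k + 1 + 1) / 2 : ℕ) + ((2 * k + 1 + 1) % 2 : ℕ) * a) / N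
      - (((2 * k + 1) / 2 : ℕ) + ((2 * k + 1) % 2 : ℕ) * a) / (N : ℝ) = (1 - a) * (1 / N) := by
  have h1 : (2 * k + 1) / 2 = k := by omega
  have h2 : (2 * k + 1) % 2 = 1 := by omega
  have h3 : (2 * k + 1 + 1) / 2 = k + 1 := by omega
  have h4 : (2 * k + 1 + 1) % 2 = 0 := by omega
  rw [h1, h2, h3, h4]
  push_cast
  ring

theorem uniform_tag_mem (N : ℕ) {a : ℝ} (ha : a ∈ Icc (0 : ℝ) 1) (i : ℕ) :
    ((i + a) / N : ℝ) ∈ Icc ((i : ℝ) / N) (((i + 1 : ℕ) : ℝ) / N) := by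
  refine ⟨div_le_div_of_nonneg_right ?_ N.cast_nonneg,
    div_le_div_of_nonneg_right ?_ N.cast_nonneg⟩
  · linarith [ha.1]
  · push_cast
    linarith [ha.2]

theorem uniformSplit_tag_mem (N : ℕ) {a : ℝ} (ha : a ∈ Icc (0 : ℝ) 1) (j : ℕ) :
    (((j / 2 : ℕ) + a) / N : ℝ) ∈ Icc (((j / 2 : ℕ) + (j % 2 : ℕ) * a) / N : ℝ)
      ((((j + 1) / 2 : ℕ) + ((j + 1) % 2 : ℕ) * a) / N) := by
  have h0 := ha.1
  have h1 := ha.2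
  refine ⟨div_le_div_of_nonneg_right ?_ N.cast_nonneg,
    div_le_div_of_nonneg_right ?_ N.cast_nonneg⟩ <;>
  rcases Nat.mod_two_eq_zero_or_one j with h | h
  · rw [h]
    push_cast
    linarith
  · rw [h]
    push_cast
    linarith
  · rw [show (j + 1) / 2 = j / 2 by omega, show (j + 1) % 2 = 1 by omega]
    push_cast
    linarith
  · rw [show (j + 1) / 2 = j / 2 + 1 by omega, show (j + 1) % 2 = 0 by omega]
    push_cast
    linarith

/-- The partition of `[0,1]` into `N` equal intervals, where the tag of each interval divides
it in the ratio `a : 1 - a`. -/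
noncomputable def uniform (N : ℕ) (hN : 0 < N) (a : ℝ) (ha : a ∈ Icc (0 : ℝ) 1) :
    TaggedPartition :=
  ofSeq N hN (fun i => i / N) (fun i => (i + a) / N) (by simp)
    (div_self (Nat.cast_ne_zero.2 hN.ne')) (uniform_tag_mem N ha)

/-- The refinement of `uniform N hN a ha` obtained by cutting each interval at its tag and
keeping that tag for both pieces. -/
noncomputable def uniformSplit (N : ℕ) (hN : 0 < N) (a : ℝ) (ha : a ∈ Icc (0 : ℝ) 1) :
    TaggedPartition :=
  ofSeq (2 * N) (by omega) (fun j => ((j / 2 : ℕ) + (j % 2 : ℕ) * a) / N)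
    (fun j => ((j / 2 : ℕ) + a) / N) (by simp)
    (by simp [hN.ne']) (uniformSplit_tag_mem N ha)

theorem mesh_uniform_le (N : ℕ) (hN : 0 < N) (a : ℝ) (ha : a ∈ Icc (0 : ℝ) 1) :
    (uniform N hN a ha).mesh ≤ 1 / N :=
  mesh_ofSeq_le fun i => (uniform_length N i).le

theorem mesh_uniformSplit_le (N : ℕ) (hN : 0 < N) (a : ℝ) (ha : a ∈ Icc (0 : ℝ) 1) :
    (uniformSplit N hN a ha).mesh ≤ 1 / N := by
  refine mesh_ofSeq_le fun i => ?_
  have hN' : (0 : ℝ) ≤ 1 / N := by positivity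
  obtain ⟨k, rfl | rfl⟩ := Nat.even_or_odd' i
  · rw [uniformSplit_length_even]
    exact mul_le_of_le_one_left hN' ha.2
  · rw [uniformSplit_length_odd]
    exact mul_le_of_le_one_left hN' (by linarith [ha.1])

end TaggedPartition

theorem Finset.sum_range_two_mul {M : Type*} [AddCommMonoid M] (f : ℕ → M) (n : ℕ) :
    ∑ j ∈ range (2 * n), f j = ∑ i ∈ range n, (f (2 * i) + f (2 * i + 1)) := by
  induction n with
  | zero => simp
  | succ n ih => rw [Nat.mul_succ, sum_range_succ, sum_range_succ, sum_range_succ, ih, add_assoc]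

section

variable {X : Type*} [NormedAddCommGroup X] [NormedSpace ℝ X] {F : ℝ → Set X} {A : Set X}

open TaggedPartition

theorem setRiemannSum_ofSeq (F : ℝ → Set X) (n : ℕ) (hn : 0 < n) (x t : ℕ → ℝ)
    (hx0 : x 0 = 0) (hxn : x n = 1) (ht : ∀ i, t i ∈ Icc (x i) (x (i + 1))) :
    setRiemannSum F (ofSeq n hn x t hx0 hxn ht) =
      ∑ i ∈ Finset.range n, (x (i + 1) - x i) • F (t i) :=
  (Finset.sum_range fun i => (x (i + 1) - x i) • F (t i)).symm

theorem setRiemannSum_uniformSplit (F : ℝ → Set X) (N : ℕ) (hN : 0 < N) (a : ℝ)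
    (ha : a ∈ Icc (0 : ℝ) 1) :
    setRiemannSum F (uniformSplit N hN a ha) =
      a • setRiemannSum F (uniform N hN a ha) +
        (1 - a) • setRiemannSum F (uniform N hN a ha) := by
  have hu : setRiemannSum F (uniform N hN a ha) = _ := setRiemannSum_ofSeq ..
  have hs : setRiemannSum F (uniformSplit N hN a ha) = _ := setRiemannSum_ofSeq ..
  rw [hu, hs, Finset.sum_range_two_mul, Finset.smul_sum, Finset.smul_sum, ← Finset.sum_add_distrib]
  refine Finset.sum_congr rfl fun k _ => ?_
  have h1 : (2 * k + 1) / 2 = k := by omega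
  rw [uniformSplit_length_even, uniformSplit_length_odd, h1, uniform_length,
    Nat.mul_div_cancel_left k two_pos, smul_smul, smul_smul]

theorem IsMultifunction.setRiemannSum_nonempty_isBounded (hF : IsMultifunction F)
    (T : TaggedPartition) : (setRiemannSum F T).Nonempty ∧ IsBounded (setRiemannSum F T) := by
  refine Finset.sum_induction _ (fun s : Set X => s.Nonempty ∧ IsBounded s)
    (fun s t hs ht => ⟨hs.1.add ht.1, hs.2.add ht.2⟩) ⟨zero_nonempty, isBounded_singleton⟩
    fun i _ => ?_
  obtain ⟨hne, hbdd⟩ := hF _ (T.tag_mem_Icc i)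
  exact ⟨hne.smul_set, hbdd.smul₀ _⟩

theorem setRiemannSum_convexHull (F : ℝ → Set X) (T : TaggedPartition) :
    setRiemannSum (fun t => convexHull ℝ (F t)) T = convexHull ℝ (setRiemannSum F T) := by
  simp only [setRiemannSum, convexHull_sum, convexHull_smul]

theorem hausdorffEDist_setRiemannSum_ne_top (hF : IsMultifunction F)
    (hFA : IsSetRiemannIntegral F A) (T : TaggedPartition) :
    hausdorffEDist (setRiemannSum F T) A ≠ ⊤ :=
  have h := hF.setRiemannSum_nonempty_isBounded T
  hausdorffEDist_ne_top_of_nonempty_of_bounded h.1 hFA.1 h.2 hFA.2.2.1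

/-- The Riemann integral of a multifunction is convex. -/
theorem IsSetRiemannIntegral.convex (hF : IsMultifunction F) (hFA : IsSetRiemannIntegral F A) :
    Convex ℝ A := by
  obtain ⟨-, hclosed, -, hlim⟩ := id hFA
  rw [convex_iff_forall_pos]
  intro u hu v hv a b ha hb hab
  obtain rfl : b = 1 - a := by linarith
  rw [← hclosed.closure_eq, Metric.mem_closure_iff]
  intro ε hε
  obtain ⟨δ, hδ, hT⟩ := hlim (ε / 2) (half_pos hε)
  obtain ⟨n, hn⟩ := exists_nat_one_div_lt hδ
  rw [← Nat.cast_succ] at hn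
  have haI : a ∈ Icc (0 : ℝ) 1 := ⟨ha.le, by linarith⟩
  have hS := hT _ ((mesh_uniform_le (n + 1) n.succ_pos a haI).trans_lt hn)
  have hS' := hT _ ((mesh_uniformSplit_le (n + 1) n.succ_pos a haI).trans_lt hn)
  have hfin := hausdorffEDist_setRiemannSum_ne_top hF hFA
  obtain ⟨p, hp, hpu⟩ := exists_dist_lt_of_hausdorffDist_lt' hu hS (hfin _)
  obtain ⟨q, hq, hqv⟩ := exists_dist_lt_of_hausdorffDist_lt' hv hS (hfin _)
  have hpq : a • p + (1 - a) • q ∈ setRiemannSum F (uniformSplit (n + 1) n.succ_pos a haI) := by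
    rw [setRiemannSum_uniformSplit]
    exact add_mem_add (smul_mem_smul_set hp) (smul_mem_smul_set hq)
  obtain ⟨w, hw, hpqw⟩ := exists_dist_lt_of_hausdorffDist_lt hpq hS' (hfin _)
  refine ⟨w, hw, ?_⟩
  have hdist : dist (a • u + (1 - a) • v) (a • p + (1 - a) • q) ≤ ε / 2 :=
    calc dist (a • u + (1 - a) • v) (a • p + (1 - a) • q)
      _ ≤ dist (a • u) (a • p) + dist ((1 - a) • v) ((1 - a) • q) := dist_add_add_le _ _ _ _
      _ = a * dist p u + (1 - a) * dist q v := by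
        rw [dist_smul₀, dist_smul₀, Real.norm_of_nonneg ha.le, Real.norm_of_nonneg hb.le,
          dist_comm u, dist_comm v]
      _ ≤ a * (ε / 2) + (1 - a) * (ε / 2) := by gcongr
      _ = ε / 2 := by ring
  linarith [dist_triangle (a • u + (1 - a) • v) (a • p + (1 - a) • q) w]

end

/-- If `F` is Riemann integrable with integral `A`, then `conv F` is Riemann integrable
with the same integral `A`. -/
theorem stmt5 {X : Type*} [NormedAddCommGroup X] [NormedSpace ℝ X] [CompleteSpace X]
    (F : ℝ → Set X) (hF : IsMultifunction F) (A : Set X)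
    (hFA : IsSetRiemannIntegral F A) :
    IsSetRiemannIntegral (fun t => convexHull ℝ (F t)) A := by
  have hconv := hFA.convex hF
  refine ⟨hFA.1, hFA.2.1, hFA.2.2.1, fun ε hε => ?_⟩
  obtain ⟨δ, hδ, hT⟩ := hFA.2.2.2 (ε / 2) (half_pos hε)
  refine ⟨δ, hδ, fun T hTδ => lt_of_le_of_lt ?_ (half_lt_self hε)⟩
  have hS := hT T hTδ
  have hfin := hausdorffEDist_setRiemannSum_ne_top hF hFA T
  rw [setRiemannSum_convexHull]
  refine hausdorffDist_le_of_mem_dist (half_pos hε).le (fun p hp => ?_) fun u hu => ?_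
  · have hsub : setRiemannSum F T ⊆ thickening (ε / 2) A := fun p hp =>
      mem_thickening_iff.2 (exists_dist_lt_of_hausdorffDist_lt hp hS hfin)
    obtain ⟨u, hu, hpu⟩ :=
      mem_thickening_iff.1 (convexHull_min hsub (hconv.thickening _) hp)
    exact ⟨u, hu, hpu.le⟩
  · obtain ⟨p, hp, hpu⟩ := exists_dist_lt_of_hausdorffDist_lt' hu hS hfin
    exact ⟨p, subset_convexHull ℝ _ hp, (dist_comm u p).trans_le hpu.le⟩
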